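/- arXiv:1811.04206 — 2 statements merged into one kernel-verified Lean document; each statement's English description precedes it below -/
import Mathlib

section
/- Let n ≥ 1 and N = 2n+1, and let σ_n be the Chafee–Infante permutation of {1,…,N}. Then: (a) σ_n is an involution, σ_n ∘ σ_n = id; (b) σ_n is dissipative, i.e., σ_n(1) = 1 and σ_n(N) = N; (c) the Morse index sequence (i_k) of σ_n satisfies i_k = min(k−1, N−k) for all 1 ≤ k ≤ N; in particular σ_n is Morse (i_k ≥ 0 for all k) and max_k i_k = n. -/
/-- The Morse index sequence `(i_k)` of a permutation `σ` (1-based indexing):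
`i_1 = 0` and `i_{k+1} = i_k + (−1)^{k+1} · sign(σ⁻¹(k+1) − σ⁻¹(k))`. -/
def morseSeq (σ : Equiv.Perm ℕ) : ℕ → ℤ
  | 0 => 0
  | 1 => 0
  | (k + 2) => morseSeq σ (k + 1) +
      (-1 : ℤ) ^ (k + 2) * Int.sign ((σ.symm (k + 2) : ℤ) - (σ.symm (k + 1) : ℤ))

/-- The Chafee–Infante map on `{1,…,2n+1}`: `k ↦ k` for odd `k`,
`k ↦ 2n+2−k` for even `k`; identity outside `{1,…,2n+1}`. -/
def CIfun (n : ℕ) : ℕ → ℕ := fun k =>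
  if k % 2 = 0 ∧ 1 ≤ k ∧ k ≤ 2 * n + 1 then 2 * n + 2 - k else k

theorem CIfun_involutive (n : ℕ) : Function.Involutive (CIfun n) := by
  intro k
  unfold CIfun
  split_ifs <;> omega

/-- The Chafee–Infante permutation `σ_n` of `{1,…,2n+1}`,
`σ_n = (2 2n)(4 2n−2)⋯` in cycle notation. -/
def CIperm (n : ℕ) : Equiv.Perm ℕ := (CIfun_involutive n).toPerm

theorem CI_symm_aux (n k : ℕ) : (CIperm n).symm k = CIfun n k := rfl

theorem CI_apply_aux (n k : ℕ) : CIperm n k = CIfun n k := rfl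

theorem CI_morse_aux (n : ℕ) (k : ℕ) (hk : k + 1 ≤ 2 * n + 1) :
    morseSeq (CIperm n) (k + 1) = min (k : ℤ) (2 * (n : ℤ) - k) := by
  induction k with
  | zero => simp [morseSeq]
  | succ k ih =>
    have ih' := ih (by omega)
    rw [morseSeq, ih', CI_symm_aux, CI_symm_aux]
    rcases Nat.even_or_odd k with h | h
    · have e1 : CIfun n (k + 2) = 2 * n + 2 - (k + 2) := by
        unfold CIfun; rw [if_pos]; grind
      have e2 : CIfun n (k + 1) = k + 1 := by
        unfold CIfun; rw [if_neg]; grind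
      have hp : (-1 : ℤ) ^ (k + 2) = 1 := Even.neg_one_pow (by grind)
      rw [e1, e2, hp]
      rcases Nat.lt_or_ge k n with hl | hl
      · rw [Int.sign_eq_one_of_pos (by omega)]; push_cast; omega
      · rw [Int.sign_eq_neg_one_of_neg (by omega)]; push_cast; omega
    · have e1 : CIfun n (k + 2) = k + 2 := by
        unfold CIfun; rw [if_neg]; grind
      have e2 : CIfun n (k + 1) = 2 * n + 2 - (k + 1) := by
        unfold CIfun; rw [if_pos]; grind
      have hp : (-1 : ℤ) ^ (k + 2) = -1 := Odd.neg_one_pow (by grind)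
      rw [e1, e2, hp]
      rcases Nat.lt_or_ge k n with hl | hl
      · rw [Int.sign_eq_neg_one_of_neg (by grind)]; push_cast; omega
      · rw [Int.sign_eq_one_of_pos (by grind)]; push_cast; omega

/-- The Chafee–Infante permutation `σ_n` is (a) an involution, (b) dissipative,
and (c) its Morse index sequence is the tent profile `i_k = min (k−1) (N−k)`;
in particular `σ_n` is Morse and `max_k i_k = n`. -/
theorem chafeeInfante_involutive_dissipative_morse (n : ℕ) (hn : 1 ≤ n) :
    (∀ k : ℕ, CIperm n (CIperm n k) = k) ∧
    (CIperm n 1 = 1 ∧ CIperm n (2 * n + 1) = 2 * n + 1) ∧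
    (∀ k : ℕ, 1 ≤ k → k ≤ 2 * n + 1 →
      morseSeq (CIperm n) k = min ((k : ℤ) - 1) (((2 * n + 1 : ℕ) : ℤ) - k)) ∧
    (∀ k : ℕ, 1 ≤ k → k ≤ 2 * n + 1 → 0 ≤ morseSeq (CIperm n) k) ∧
    (∀ k : ℕ, 1 ≤ k → k ≤ 2 * n + 1 → morseSeq (CIperm n) k ≤ (n : ℤ)) ∧
    (∃ k : ℕ, 1 ≤ k ∧ k ≤ 2 * n + 1 ∧ morseSeq (CIperm n) k = (n : ℤ)) := by
  have H : ∀ k : ℕ, 1 ≤ k → k ≤ 2 * n + 1 →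
      morseSeq (CIperm n) k = min ((k : ℤ) - 1) (((2 * n + 1 : ℕ) : ℤ) - k) := by
    intro k h1 h2
    obtain ⟨j, rfl⟩ : ∃ j, k = j + 1 := ⟨k - 1, by omega⟩
    rw [CI_morse_aux n j h2]
    push_cast
    omega
  refine ⟨fun k => CIfun_involutive n k, ⟨?_, ?_⟩, H, ?_, ?_, n + 1, by omega, by omega, ?_⟩
  · rw [CI_apply_aux]; unfold CIfun; rw [if_neg]; omega
  · rw [CI_apply_aux]; unfold CIfun; rw [if_neg]; omega
  · intro k h1 h2
    rw [H k h1 h2]; omega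
  · intro k h1 h2
    rw [H k h1 h2]; omega
  · rw [H (n + 1) (by omega) (by omega)]; push_cast; omega
end

section
/- Let n ≥ 1 and N = 2n+1. Then the Chafee–Infante permutation σ_n of {1,…,N} is a meander permutation: no two arcs of the same parity cross. -/
/-- `σ` is a meander permutation of `{1,…,N}`: no two arcs of the same parity
cross.  For `1 ≤ j < k ≤ N−1` with `j ≡ k (mod 2)`, with
`a = min(σ⁻¹(j), σ⁻¹(j+1))`, `b = max(σ⁻¹(j), σ⁻¹(j+1))`,
`c = min(σ⁻¹(k), σ⁻¹(k+1))`, `d = max(σ⁻¹(k), σ⁻¹(k+1))`,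
neither `a < c < b < d` nor `c < a < d < b` holds. -/
def IsMeander (N : ℕ) (σ : Equiv.Perm ℕ) : Prop :=
  ∀ j k : ℕ, 1 ≤ j → j < k → k + 1 ≤ N → j % 2 = k % 2 →
    ¬ (min (σ.symm j) (σ.symm (j + 1)) < min (σ.symm k) (σ.symm (k + 1)) ∧
       min (σ.symm k) (σ.symm (k + 1)) < max (σ.symm j) (σ.symm (j + 1)) ∧
       max (σ.symm j) (σ.symm (j + 1)) < max (σ.symm k) (σ.symm (k + 1))) ∧
    ¬ (min (σ.symm k) (σ.symm (k + 1)) < min (σ.symm j) (σ.symm (j + 1)) ∧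
       min (σ.symm j) (σ.symm (j + 1)) < max (σ.symm k) (σ.symm (k + 1)) ∧
       max (σ.symm k) (σ.symm (k + 1)) < max (σ.symm j) (σ.symm (j + 1)))

/-- The Chafee–Infante permutation `σ_n` of `{1,…,2n+1}` is a meander
permutation: no two arcs of the same parity cross. -/
theorem chafeeInfante_isMeander (n : ℕ) (hn : 1 ≤ n) :
    IsMeander (2 * n + 1) (CIperm n) := by
  intro j k hj hjk hk hpar
  have hs : ∀ m, (CIperm n).symm m = CIfun n m := fun m => rfl
  simp only [hs]
  rcases Nat.mod_two_eq_zero_or_one j with h | h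
  · have e1 : CIfun n j = 2 * n + 2 - j := if_pos (by omega)
    have e2 : CIfun n (j + 1) = j + 1 := if_neg (by omega)
    have e3 : CIfun n k = 2 * n + 2 - k := if_pos (by omega)
    have e4 : CIfun n (k + 1) = k + 1 := if_neg (by omega)
    rw [e1, e2, e3, e4]
    omega
  · have e1 : CIfun n j = j := if_neg (by omega)
    have e2 : CIfun n (j + 1) = 2 * n + 2 - (j + 1) := if_pos (by omega)
    have e3 : CIfun n k = k := if_neg (by omega)
    have e4 : CIfun n (k + 1) = 2 * n + 2 - (k + 1) := if_pos (by omega)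
    rw [e1, e2, e3, e4]
    omega
end
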